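/- Let A be a C*-algebra in which tripotents are norm-total, and let T : A → A be a bounded linear map. Then T is a triple derivation if and only if for every tripotent e ∈ A the following two conditions hold: (i) P₀(e)(T(e)) = 0, i.e. T(e) − e e* T(e) − T(e) e* e + e e* T(e) e* e = 0; and (ii) for all x, y, z ∈ A with P₂(e)(x) = x, P₂(e)(y) = y, P₂(e)(z) = z, one has P₂(e)(T({x,y,z})) = {P₂(e)(T(x)), y, z} + {x, P₂(e)(T(y)), z} + {x, y, P₂(e)(T(z))}. -/

import Mathlib

variable {A : Type*} [NonUnitalNormedRing A] [StarRing A] [CStarRing A]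
  [NormedSpace ℂ A] [IsScalarTower ℂ A A] [SMulCommClass ℂ A A]
  [StarModule ℂ A] [CompleteSpace A]

/-- The triple product `{x,y,z} = (1/2)(x y* z + z y* x)` on a C*-algebra. -/
noncomputable def tp (x y z : A) : A := (2⁻¹ : ℂ) • (x * star y * z + z * star y * x)

/-- Orthogonality: `a ⊥ b` iff `a b* = 0` and `b* a = 0`. -/
def Orthog (a b : A) : Prop := a * star b = 0 ∧ star b * a = 0

/-- A triple derivation. -/
def IsTripleDerivation (δ : A → A) : Prop :=
  ∀ a b c : A, δ (tp a b c) = tp (δ a) b c + tp a (δ b) c + tp a b (δ c)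

/-- The Peirce 2-projection `P₂(e)(x) = e e* x e* e` associated with a tripotent `e`. -/
def P₂ (e x : A) : A := e * star e * x * star e * e

set_option linter.unusedSectionVars false

lemma tp_add_left (a a' b c : A) : tp (a + a') b c = tp a b c + tp a' b c := by
  simp only [tp, add_mul, mul_add]; module

lemma tp_add_mid (a b b' c : A) : tp a (b + b') c = tp a b c + tp a b' c := by
  simp only [tp, star_add, add_mul, mul_add]; module

lemma tp_smul_left (r : ℂ) (a b c : A) : tp (r • a) b c = r • tp a b c := by
  simp only [tp, smul_mul_assoc, mul_smul_comm]; module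

lemma tp_smul_mid (r : ℂ) (a b c : A) : tp a (r • b) c = star r • tp a b c := by
  simp only [tp, star_smul, smul_mul_assoc, mul_smul_comm]; module

lemma tp_comm (a b c : A) : tp a b c = tp c b a := by
  simp only [tp, add_comm]

/-- The failure of `T` to satisfy the triple Leibniz rule at `(a, b, c)`. -/
noncomputable def leibnizDefect (T : A →L[ℂ] A) (a b c : A) : A :=
  T (tp a b c) - (tp (T a) b c + tp a (T b) c + tp a b (T c))

section LeibnizDefect

variable (T : A →L[ℂ] A)

lemma leibnizDefect_comm (a b c : A) : leibnizDefect T a b c = leibnizDefect T c b a := by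
  simp only [leibnizDefect, tp_comm a, tp_comm (T a)]; abel

lemma leibnizDefect_add_left (a a' b c : A) :
    leibnizDefect T (a + a') b c = leibnizDefect T a b c + leibnizDefect T a' b c := by
  simp only [leibnizDefect, tp_add_left, map_add]; abel

lemma leibnizDefect_add_mid (a b b' c : A) :
    leibnizDefect T a (b + b') c = leibnizDefect T a b c + leibnizDefect T a b' c := by
  simp only [leibnizDefect, tp_add_mid, map_add]; abel

lemma leibnizDefect_add_right (a b c c' : A) :
    leibnizDefect T a b (c + c') = leibnizDefect T a b c + leibnizDefect T a b c' := by
  simp only [leibnizDefect_comm T a, leibnizDefect_add_left]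

lemma leibnizDefect_smul_left (r : ℂ) (a b c : A) :
    leibnizDefect T (r • a) b c = r • leibnizDefect T a b c := by
  simp only [leibnizDefect, tp_smul_left, map_smul]; module

lemma leibnizDefect_smul_mid (r : ℂ) (a b c : A) :
    leibnizDefect T a (r • b) c = star r • leibnizDefect T a b c := by
  simp only [leibnizDefect, tp_smul_mid, map_smul]; module

lemma leibnizDefect_smul_right (r : ℂ) (a b c : A) :
    leibnizDefect T a b (r • c) = r • leibnizDefect T a b c := by
  simp only [leibnizDefect_comm T a, leibnizDefect_smul_left]

lemma leibnizDefect_sum_left {ι : Type*} (s : Finset ι) (f : ι → A) (b c : A) :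
    leibnizDefect T (∑ i ∈ s, f i) b c = ∑ i ∈ s, leibnizDefect T (f i) b c :=
  map_sum (AddMonoidHom.mk' (leibnizDefect T · b c)
    fun a a' ↦ leibnizDefect_add_left T a a' b c) f s

lemma leibnizDefect_sum_mid {ι : Type*} (s : Finset ι) (f : ι → A) (a c : A) :
    leibnizDefect T a (∑ i ∈ s, f i) c = ∑ i ∈ s, leibnizDefect T a (f i) c :=
  map_sum (AddMonoidHom.mk' (leibnizDefect T a · c)
    fun b b' ↦ leibnizDefect_add_mid T a b b' c) f s

lemma leibnizDefect_sum_right {ι : Type*} (s : Finset ι) (f : ι → A) (a b : A) :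
    leibnizDefect T a b (∑ i ∈ s, f i) = ∑ i ∈ s, leibnizDefect T a b (f i) := by
  simp only [leibnizDefect_comm T a, leibnizDefect_sum_left]

lemma continuous_leibnizDefect_diag : Continuous fun a ↦ leibnizDefect T a a a := by
  unfold leibnizDefect tp
  fun_prop

variable {T}

lemma isTripleDerivation_iff_leibnizDefect :
    IsTripleDerivation (T : A → A) ↔ ∀ a b c, leibnizDefect T a b c = 0 := by
  simp only [IsTripleDerivation, leibnizDefect, sub_eq_zero]

/-- Polarization: the defect is a trigonometric polynomial in `r` along `x + r • y`, `|r| = 1`,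
and its coefficients of degree `-1` and `0` vanish. -/
lemma leibnizDefect_polarization {x y : A}
    (h : ∀ r : ℂ, r * star r = 1 → leibnizDefect T (x + r • y) (x + r • y) (x + r • y) = 0) :
    leibnizDefect T x y x = 0 ∧
      leibnizDefect T x x x + (2 : ℂ) • leibnizDefect T x y y = 0 := by
  have h1 := h 1 (by simp)
  have h2 := h (-1) (by simp)
  have h3 := h Complex.I (by simp)
  have h4 := h (-Complex.I) (by simp)
  have hI : Complex.I * Complex.I = -1 := Complex.I_mul_I
  simp only [leibnizDefect_add_left, leibnizDefect_add_mid, leibnizDefect_add_right,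
    leibnizDefect_smul_left, leibnizDefect_smul_mid, leibnizDefect_smul_right,
    leibnizDefect_comm T y _ x, star_neg, star_one, Complex.star_def, Complex.conj_I, smul_add,
    smul_smul, neg_mul, mul_neg, hI, neg_neg, one_smul, mul_one] at h1 h2 h3 h4
  constructor
  · have h34 : (2 * Complex.I) • ((2 : ℂ) • leibnizDefect T x x y - leibnizDefect T x y x +
        leibnizDefect T y y y) = 0 := by
      linear_combination (norm := module) h3 - h4
    replace h34 := (smul_eq_zero_iff_right (by simp)).1 h34
    have : (4 : ℂ) • leibnizDefect T x y x = 0 := by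
      linear_combination (norm := module) h1 - h2 - (2 : ℂ) • h34
    exact (smul_eq_zero_iff_right (by norm_num)).1 this
  · have : (4 : ℂ) • (leibnizDefect T x x x + (2 : ℂ) • leibnizDefect T x y y) = 0 := by
      linear_combination (norm := module) h1 + h2 + h3 + h4
    exact (smul_eq_zero_iff_right (by norm_num)).1 this

lemma leibnizDefect_eq_zero_of_diag (h : ∀ a, leibnizDefect T a a a = 0) (a b c : A) :
    leibnizDefect T a b c = 0 := by
  have key (x y : A) : leibnizDefect T x y x = 0 :=
    (leibnizDefect_polarization fun r _ ↦ h _).1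
  have hac := key (a + c) b
  rw [leibnizDefect_add_left, leibnizDefect_add_right, leibnizDefect_add_right, key, key,
    leibnizDefect_comm T c b a, zero_add, add_zero] at hac
  rw [← two_smul ℂ] at hac
  simpa using hac

end LeibnizDefect

lemma Orthog.symm {a b : A} (h : Orthog a b) : Orthog b a :=
  ⟨by simpa using congrArg star h.1, by simpa using congrArg star h.2⟩

lemma Orthog.smul_right {a b : A} (h : Orthog a b) (r : ℂ) : Orthog a (r • b) := by
  simp only [Orthog, star_smul, mul_smul_comm, smul_mul_assoc, h.1, h.2, smul_zero, and_self]

lemma Orthog.add_left {a b c : A} (hac : Orthog a c) (hbc : Orthog b c) : Orthog (a + b) c := by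
  simp [Orthog, add_mul, mul_add, hac.1, hac.2, hbc.1, hbc.2]

lemma tripotent_smul {e : A} (he : e * star e * e = e) {r : ℂ} (hr : r * star r = 1) :
    (r • e) * star (r • e) * (r • e) = r • e := by
  simp only [star_smul, smul_mul_assoc, mul_smul_comm, he, smul_smul]
  rw [mul_comm (star r), hr, mul_one]

lemma Orthog.tripotent_add {e f : A} (h : Orthog e f) (he : e * star e * e = e)
    (hf : f * star f * f = f) : (e + f) * star (e + f) * (e + f) = e + f := by
  have h' := h.symm
  simp only [star_add, mul_add, add_mul, h.1, h'.1, mul_assoc, h.2, h'.2] at *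
  simp [he, hf]

lemma leibnizDefect_of_orthog {T : A →L[ℂ] A}
    (hT : ∀ e : A, e * star e * e = e → leibnizDefect T e e e = 0)
    {e f : A} (h : Orthog e f) (he : e * star e * e = e)
    (hf : f * star f * f = f) :
    leibnizDefect T e f e = 0 ∧ leibnizDefect T e f f = 0 := by
  have key := leibnizDefect_polarization (T := T) (x := e) (y := f) fun r hr ↦
    hT _ ((h.smul_right r).tripotent_add he (tripotent_smul hf hr))
  refine ⟨key.1, ?_⟩
  simpa [hT e he] using key.2

lemma leibnizDefect_of_pairwise_orthog {T : A →L[ℂ] A}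
    (hT : ∀ e : A, e * star e * e = e → leibnizDefect T e e e = 0)
    {ι : Type*} {e : ι → A}
    (he : ∀ i, e i * star (e i) * e i = e i) (horth : ∀ i j, i ≠ j → Orthog (e i) (e j))
    (i j k : ι) : leibnizDefect T (e i) (e j) (e k) = 0 := by
  have hpair {i j : ι} (hij : i ≠ j) :=
    leibnizDefect_of_orthog hT (horth i j hij) (he i) (he j)
  by_cases hij : i = j
  · subst hij
    by_cases hik : i = k
    · subst hik
      exact hT _ (he i)
    · rw [leibnizDefect_comm]
      exact (hpair (Ne.symm hik)).2
  by_cases hjk : j = k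
  · subst hjk
    exact (hpair hij).2
  by_cases hik : i = k
  · subst hik
    exact (hpair hij).1
  have hsum := (leibnizDefect_of_orthog hT
    ((horth i j hij).add_left (horth k j (Ne.symm hjk)))
    ((horth i k hik).tripotent_add (he i) (he k)) (he j)).1
  simp only [leibnizDefect_add_left, leibnizDefect_add_right, (hpair hij).1,
    (hpair (Ne.symm hjk)).1, leibnizDefect_comm T (e k) _ (e i), zero_add, add_zero] at hsum
  rw [← two_smul ℂ] at hsum
  simpa using hsum

lemma tp_self {e : A} (he : e * star e * e = e) : tp e e e = e := by
  rw [tp, he]; module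

lemma leibnizDefect_tripotent {T : A →L[ℂ] A} {e : A} (he : e * star e * e = e)
    (h₀ : T e - e * star e * T e - T e * star e * e + e * star e * T e * star e * e = 0)
    (h₂ : P₂ e (T (tp e e e)) = tp (P₂ e (T e)) e e + tp e (P₂ e (T e)) e + tp e e (P₂ e (T e))) :
    leibnizDefect T e e e = 0 := by
  have he' (x : A) : e * (star e * (e * x)) = e * x := by simpa [mul_assoc] using congrArg (· * x) he
  have hs : star e * (e * star e) = star e := by simpa using congrArg star he
  have hs' (x : A) : star e * (e * (star e * x)) = star e * x := by
    simpa [mul_assoc] using congrArg (· * x) hs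
  have h₁ : e * (star e * e) = e := by rwa [← mul_assoc]
  rw [leibnizDefect, tp_self he]
  rw [tp_self he] at h₂
  simp only [P₂, tp, star_mul, star_star, mul_assoc, he', hs', hs, h₁] at *
  linear_combination (norm := module) h₀ + h₂

lemma IsTripleDerivation.peirce_zero {T : A → A} (hT : IsTripleDerivation T) {e : A}
    (he : e * star e * e = e) :
    T e - e * star e * T e - T e * star e * e + e * star e * T e * star e * e = 0 := by
  have hTe := hT e e e
  rw [tp_self he] at hTe
  have he' (x : A) : e * (star e * (e * x)) = e * x := by
    simpa only [mul_assoc] using congrArg (· * x) he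
  have he₁ : e * (star e * e) = e := by rwa [← mul_assoc]
  rw [hTe]
  simp only [tp, mul_add, add_mul, mul_smul_comm, smul_mul_assoc, mul_assoc, he', he₁]
  module

lemma IsTripleDerivation.peirce_two {T : A → A} (hT : IsTripleDerivation T) {e : A}
    (he : e * star e * e = e) {x y z : A}
    (hx : P₂ e x = x) (hy : P₂ e y = y) (hz : P₂ e z = z) :
    P₂ e (T (tp x y z)) =
      tp (P₂ e (T x)) y z + tp x (P₂ e (T y)) z + tp x y (P₂ e (T z)) := by
  have left {w : A} (hw : P₂ e w = w) : e * star e * w = w := by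
    rw [← hw, P₂]; simp only [← mul_assoc, he]
  have right {w : A} (hw : P₂ e w = w) : w * (star e * e) = w := by
    have he₁ : e * (star e * e) = e := by rwa [← mul_assoc]
    rw [← hw, P₂]; simp only [mul_assoc, he₁]
  have left' {w : A} (hw : P₂ e w = w) (v : A) : e * (star e * (w * v)) = w * v := by
    simpa only [mul_assoc] using congrArg (· * v) (left hw)
  have right' {w : A} (hw : P₂ e w = w) (v : A) : w * (star e * (e * v)) = w * v := by
    simpa only [mul_assoc] using congrArg (· * v) (right hw)
  have star_left (v : A) : star e * (e * (star y * v)) = star y * v := by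
    simpa only [star_mul, star_star, mul_assoc] using congrArg (star · * v) (right hy)
  have star_right (v : A) : star y * (e * (star e * v)) = star y * v := by
    simpa only [star_mul, star_star, mul_assoc] using congrArg (star · * v) (left hy)
  have left_z : e * (star e * z) = z := by simpa only [mul_assoc] using left hz
  have left_x : e * (star e * x) = x := by simpa only [mul_assoc] using left hx
  rw [hT]
  simp only [P₂, tp, star_mul, star_star, mul_add, add_mul, mul_smul_comm, smul_mul_assoc,
    mul_assoc, left' hx, left' hz, right hx, right hz, right' hx, right' hz, star_left, star_right,
    left_x, left_z]

/-- in a C*-algebra whose tripotents are norm-total, a bounded linear map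
`T` is a triple derivation iff for every tripotent `e`: (i) `P₀(e)(T e) = 0` and
(ii) the compression of `T` to the Peirce 2-space `A₂(e)` is a triple derivation. -/
theorem stmt13 (T : A →L[ℂ] A)
    (htot : ∀ a : A, ∀ ε : ℝ, 0 < ε →
      ∃ (n : ℕ) (e : Fin n → A) (lam : Fin n → ℂ),
        (∀ i, e i * star (e i) * e i = e i) ∧
        (∀ i j, i ≠ j → Orthog (e i) (e j)) ∧
        ‖a - ∑ i, lam i • e i‖ < ε) :
    IsTripleDerivation (T : A → A) ↔
      (∀ e : A, e * star e * e = e →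
        (T e - e * star e * T e - T e * star e * e + e * star e * T e * star e * e = 0) ∧
        (∀ x y z : A, P₂ e x = x → P₂ e y = y → P₂ e z = z →
          P₂ e (T (tp x y z)) =
            tp (P₂ e (T x)) y z + tp x (P₂ e (T y)) z + tp x y (P₂ e (T z)))) := by
  refine ⟨fun hT e he ↦ ⟨hT.peirce_zero he, fun x y z ↦ hT.peirce_two he⟩, fun h ↦ ?_⟩
  have htrip (e : A) (he : e * star e * e = e) : leibnizDefect T e e e = 0 := by
    have hP : P₂ e e = e := by rw [P₂, he, he]
    exact leibnizDefect_tripotent he (h e he).1 ((h e he).2 e e e hP hP hP)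
  refine isTripleDerivation_iff_leibnizDefect.2 (leibnizDefect_eq_zero_of_diag fun a ↦ ?_)
  have hclosed : IsClosed {a : A | leibnizDefect T a a a = 0} :=
    isClosed_eq (continuous_leibnizDefect_diag T) continuous_const
  refine hclosed.closure_subset (Metric.mem_closure_iff.2 fun ε hε ↦ ?_)
  obtain ⟨n, e, lam, he, horth, hlt⟩ := htot a ε hε
  refine ⟨∑ i, lam i • e i, ?_, by rwa [dist_eq_norm]⟩
  simp [leibnizDefect_sum_left, leibnizDefect_sum_mid, leibnizDefect_sum_right,
    leibnizDefect_smul_left, leibnizDefect_smul_mid, leibnizDefect_smul_right,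
    leibnizDefect_of_pairwise_orthog htrip he horth]
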